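/- Hellinger affinity between the conditional posterior at the true model and its Gaussian limit (key step in the Bernstein–von Mises theorem): assume s* = o(√n / log n). Then E_{β*}[∫_{ℝ^{s*}} √( π^n(β_{S*}|S*) · φ(β_{S*}; β̂_{S*}, (σ₀²/(α+γ))(X_{S*}ᵀX_{S*})⁻¹) ) dβ_{S*}] → 1 as n → ∞, uniformly over all true coefficient vectors β* satisfying the assumptions, where φ(·; μ, Σ) denotes the N_{s*}(μ, Σ) density. -/

import Mathlib

open MeasureTheory ProbabilityTheory Real Filter Matrix
open scoped ENNReal NNReal BigOperators Classical

noncomputable section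

namespace EmpiricalBayes

/-- Submatrix of columns of `X` indexed by `S`. -/
def XS {n p : ℕ} (X : Matrix (Fin n) (Fin p) ℝ) (S : Finset (Fin p)) :
    Matrix (Fin n) {j // j ∈ S} ℝ := Matrix.of fun i j => X i j.1

/-- The Gram matrix `X_Sᵀ X_S`. -/
def gram {n p : ℕ} (X : Matrix (Fin n) (Fin p) ℝ) (S : Finset (Fin p)) :
    Matrix {j // j ∈ S} {j // j ∈ S} ℝ := (XS X S)ᵀ * XS X S

/-- Least squares estimator `β̂_S = (X_SᵀX_S)⁻¹X_Sᵀ y`. -/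
def betaHat {n p : ℕ} (X : Matrix (Fin n) (Fin p) ℝ) (S : Finset (Fin p))
    (y : Fin n → ℝ) : {j // j ∈ S} → ℝ := ((gram X S)⁻¹ * (XS X S)ᵀ).mulVec y

/-- Fitted values `ŷ_S = X_S β̂_S`. -/
def yHat {n p : ℕ} (X : Matrix (Fin n) (Fin p) ℝ) (S : Finset (Fin p))
    (y : Fin n → ℝ) : Fin n → ℝ := (XS X S).mulVec (betaHat X S y)

/-- Residual sum of squares `‖y - ŷ_S‖²`. -/
def rss {n p : ℕ} (X : Matrix (Fin n) (Fin p) ℝ) (S : Finset (Fin p))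
    (y : Fin n → ℝ) : ℝ := ∑ i, (y i - yHat X S y i) ^ 2

/-- Quadratic form `(β_S - β̂_S)ᵀ X_SᵀX_S (β_S - β̂_S)`. -/
def quadForm {n p : ℕ} (X : Matrix (Fin n) (Fin p) ℝ) (S : Finset (Fin p))
    (y : Fin n → ℝ) (b : {j // j ∈ S} → ℝ) : ℝ :=
  (b - betaHat X S y) ⬝ᵥ ((gram X S).mulVec (b - betaHat X S y))

/-- Prior weight `π(S) = binom(p,|S|)⁻¹ (c p^a)^{-|S|}` for `|S| ≤ R`, `0` otherwise
(the normalizing constant of `f_n` is irrelevant, as it cancels in the posterior). -/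
def priorWt (p R : ℕ) (a c : ℝ) (S : Finset (Fin p)) : ℝ :=
  if S.card ≤ R then ((p.choose S.card : ℝ))⁻¹ * (c * (p : ℝ) ^ a) ^ (-(S.card : ℝ)) else 0

/-- Exponent `nα/2 + s/2 + a₀` of the multivariate t kernel. -/
def tExp (n : ℕ) (α a₀ : ℝ) (s : ℕ) : ℝ := n * α / 2 + s / 2 + a₀

/-- The (unnormalized) density `D_S^n(β_S)` of the empirical Bayes posterior on model `S`. -/
def Ddens {n p : ℕ} (R : ℕ) (X : Matrix (Fin n) (Fin p) ℝ) (a₀ b₀ a c γ α : ℝ)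
    (y : Fin n → ℝ) (S : Finset (Fin p)) (b : {j // j ∈ S} → ℝ) : ℝ :=
  priorWt p R a c S * (2 * π) ^ (-(S.card : ℝ) / 2) * Real.Gamma (tExp n α a₀ S.card) *
    Real.sqrt ((γ • gram X S).det) *
    (b₀ + (α + γ) / 2 * quadForm X S y b + α / 2 * rss X S y) ^ (-(tExp n α a₀ S.card))

/-- Augment `β_S` with zeros outside `S`. -/
def augment {p : ℕ} (S : Finset (Fin p)) (b : {j // j ∈ S} → ℝ) : Fin p → ℝ :=
  fun j => if h : j ∈ S then b ⟨j, h⟩ else 0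

/-- The contribution `∫ D_S^n(dβ_S) δ_0(dβ_{S^c})` of model `S` to the (unnormalized)
empirical Bayes posterior. -/
def modelMeasure {n p : ℕ} (R : ℕ) (X : Matrix (Fin n) (Fin p) ℝ) (a₀ b₀ a c γ α : ℝ)
    (y : Fin n → ℝ) (S : Finset (Fin p)) : Measure (Fin p → ℝ) :=
  Measure.map (augment S)
    ((volume : Measure ({j // j ∈ S} → ℝ)).withDensity
      fun b => ENNReal.ofReal (Ddens R X a₀ b₀ a c γ α y S b))

/-- The unnormalized empirical Bayes posterior `Σ_S ∫ D_S^n(dβ_S) δ_0(dβ_{S^c})`. -/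
def postUnnorm {n p : ℕ} (R : ℕ) (X : Matrix (Fin n) (Fin p) ℝ) (a₀ b₀ a c γ α : ℝ)
    (y : Fin n → ℝ) : Measure (Fin p → ℝ) :=
  ∑ S : Finset (Fin p), modelMeasure R X a₀ b₀ a c γ α y S

/-- The empirical Bayes posterior `Π^n` on `ℝ^p`. -/
def post {n p : ℕ} (R : ℕ) (X : Matrix (Fin n) (Fin p) ℝ) (a₀ b₀ a c γ α : ℝ)
    (y : Fin n → ℝ) : Measure (Fin p → ℝ) :=
  (postUnnorm R X a₀ b₀ a c γ α y Set.univ)⁻¹ • postUnnorm R X a₀ b₀ a c γ α y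

/-- The Gaussian measure `N_n(m, v I_n)` on `ℝⁿ`. -/
def gaussVec (n : ℕ) (m : Fin n → ℝ) (v : ℝ) : Measure (Fin n → ℝ) :=
  Measure.pi fun i => gaussianReal (m i) v.toNNReal

/-- The sampling distribution of the data, `y ~ N_n(Xβ*, σ₀² I_n)`. -/
def dataDist {n p : ℕ} (X : Matrix (Fin n) (Fin p) ℝ) (βstar : Fin p → ℝ)
    (σ0sq : ℝ) : Measure (Fin n → ℝ) := gaussVec n (X.mulVec βstar) σ0sq

/-- Unnormalized marginal posterior model weight
`π(S)(γ/(α+γ))^{|S|/2}(b₀ + α‖y-ŷ_S‖²/2)^{-(a₀+αn/2)}`. -/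
def modelWt {n p : ℕ} (R : ℕ) (X : Matrix (Fin n) (Fin p) ℝ) (a₀ b₀ a c γ α : ℝ)
    (y : Fin n → ℝ) (S : Finset (Fin p)) : ℝ :=
  priorWt p R a c S * (γ / (α + γ)) ^ ((S.card : ℝ) / 2) *
    (b₀ + α / 2 * rss X S y) ^ (-(a₀ + α * n / 2))

/-- The marginal posterior probability `π^n(S)` of model `S`. -/
def postModel {n p : ℕ} (R : ℕ) (X : Matrix (Fin n) (Fin p) ℝ) (a₀ b₀ a c γ α : ℝ)
    (y : Fin n → ℝ) (S : Finset (Fin p)) : ℝ :=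
  modelWt R X a₀ b₀ a c γ α y S / ∑ S' : Finset (Fin p), modelWt R X a₀ b₀ a c γ α y S'

/-- The compatibility number `κ(s) = inf{‖Xβ‖₂/‖β‖₂ : 0 < |S_β| ≤ s}`. -/
def kappa {n p : ℕ} (X : Matrix (Fin n) (Fin p) ℝ) (s : ℝ) : ℝ :=
  sInf ((fun β : Fin p → ℝ =>
      Real.sqrt (∑ i, (X.mulVec β i) ^ 2) / Real.sqrt (∑ j, β j ^ 2)) ''
    {β | 0 < (Function.support β).ncard ∧ ((Function.support β).ncard : ℝ) ≤ s})

/-- Orthogonal projection `P_S = X_S(X_SᵀX_S)⁻¹X_Sᵀ` onto the column span of `X_S`. -/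
def projMat {n p : ℕ} (X : Matrix (Fin n) (Fin p) ℝ) (S : Finset (Fin p)) :
    Matrix (Fin n) (Fin n) ℝ := XS X S * (gram X S)⁻¹ * (XS X S)ᵀ

/-- Support of a coefficient vector as a `Finset`. -/
def suppFinset {p : ℕ} (β : Fin p → ℝ) : Finset (Fin p) :=
  Finset.univ.filter fun j => β j ≠ 0

/-- The conditional posterior density of `β_{S}` given model `S`: the multivariate t
density with `2a₀+αn` degrees of freedom, location `β̂_S` and scale matrix
`[(b₀+(α/2)‖y−ŷ_S‖²)/(a₀+αn/2)]·(1/(α+γ))(X_SᵀX_S)⁻¹`. -/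
def tCondDensity {n p : ℕ} (X : Matrix (Fin n) (Fin p) ℝ) (a₀ b₀ γ α : ℝ)
    (y : Fin n → ℝ) (S : Finset (Fin p)) (b : {j // j ∈ S} → ℝ) : ℝ :=
  (2 * π) ^ (-(S.card : ℝ) / 2) *
    (Real.Gamma (n * α / 2 + S.card / 2 + a₀) / Real.Gamma (n * α / 2 + a₀)) *
    Real.sqrt (((α + γ) • gram X S).det) *
    (b₀ + α / 2 * rss X S y) ^ (n * α / 2 + a₀) *
    (b₀ + (α + γ) / 2 * quadForm X S y b + α / 2 * rss X S y) ^
      (-(n * α / 2 + S.card / 2 + a₀))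

/-- The density of `N_{|S|}(β̂_S, (σ₀²/(α+γ))(X_SᵀX_S)⁻¹)`. -/
def gaussCondDensity {n p : ℕ} (X : Matrix (Fin n) (Fin p) ℝ) (γ α σ0sq : ℝ)
    (y : Fin n → ℝ) (S : Finset (Fin p)) (b : {j // j ∈ S} → ℝ) : ℝ :=
  (2 * π * σ0sq / (α + γ)) ^ (-(S.card : ℝ) / 2) * Real.sqrt ((gram X S).det) *
    Real.exp (-((α + γ) / (2 * σ0sq)) * quadForm X S y b)

lemma gammaMeasure_ae_pos (k A : ℝ) : ∀ᵐ x ∂gammaMeasure k A, 0 < x := by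
  have h0 : ∀ᵐ x : ℝ ∂volume, x ≠ 0 := by simp [ae_iff]
  rw [gammaMeasure, ae_withDensity_iff (by unfold gammaPDF; fun_prop)]
  filter_upwards [h0] with x hx hpdf
  by_contra hneg
  exact hpdf (gammaPDF_of_neg (lt_of_le_of_ne (not_lt.mp hneg) hx))

/-- Power moments of the Gamma distribution, exponentially tilted. -/
lemma lintegral_rpow_mul_exp_gammaMeasure {k A r u : ℝ} (hk : 0 < k) (hA : 0 < A)
    (hkr : 0 < k + r) (hAu : 0 < A + u) :
    ∫⁻ x, ENNReal.ofReal (x ^ r * Real.exp (-(u * x))) ∂gammaMeasure k A =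
      ENNReal.ofReal (A ^ k / Real.Gamma k * (Real.Gamma (k + r) * (A + u) ^ (-(k + r)))) := by
  have hΓ := Real.Gamma_pos_of_pos hk
  have hΓ' := Real.Gamma_pos_of_pos hkr
  have h0 : ∀ᵐ x : ℝ ∂volume, x ≠ 0 := by simp [ae_iff]
  rw [gammaMeasure, lintegral_withDensity_eq_lintegral_mul _ (by unfold gammaPDF; fun_prop)
    (by fun_prop)]
  have key : ∀ᵐ x : ℝ ∂volume,
      (gammaPDF k A * fun x => ENNReal.ofReal (x ^ r * Real.exp (-(u * x)))) x =
      ENNReal.ofReal (A ^ k / Real.Gamma k * (Real.Gamma (k + r) * (A + u) ^ (-(k + r)))) *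
        gammaPDF (k + r) (A + u) x := by
    filter_upwards [h0] with x hx
    rw [Pi.mul_apply]
    rcases lt_or_gt_of_ne hx with hx | hx
    · simp [gammaPDF_of_neg hx]
    · rw [gammaPDF_of_nonneg hx.le, gammaPDF_of_nonneg hx.le, ← ENNReal.ofReal_mul (by positivity),
        ← ENNReal.ofReal_mul (by positivity)]
      congr 1
      rw [show k + r - 1 = (k - 1) + r by ring, Real.rpow_add hx, Real.rpow_neg hAu.le,
        show -((A + u) * x) = -(A * x) + -(u * x) by ring, Real.exp_add]
      have : (A + u) ^ (k + r) ≠ 0 := by positivity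
      field_simp
  rw [lintegral_congr_ae key, lintegral_const_mul _ (by unfold gammaPDF; fun_prop),
    lintegral_gammaPDF_eq_one hkr hAu, mul_one]

lemma hasInvMoments_gammaMeasure {k A : ℝ} (hk : 2 < k) (hA : 0 < A) :
    (Integrable (fun x : ℝ => x⁻¹) (gammaMeasure k A) ∧
      ∫ x, x⁻¹ ∂gammaMeasure k A = A / (k - 1)) ∧
    (Integrable (fun x : ℝ => (x ^ 2)⁻¹) (gammaMeasure k A) ∧
      ∫ x, (x ^ 2)⁻¹ ∂gammaMeasure k A = A ^ 2 / ((k - 1) * (k - 2))) := by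
  have hpos := gammaMeasure_ae_pos k A
  have aux : ∀ {f : ℝ → ℝ} {v : ℝ}, Measurable f → (∀ x, 0 < x → 0 ≤ f x) → 0 ≤ v →
      ∫⁻ x, ENNReal.ofReal (f x) ∂gammaMeasure k A = ENNReal.ofReal v →
      Integrable f (gammaMeasure k A) ∧ ∫ x, f x ∂gammaMeasure k A = v := by
    intro f v hf hf0 hv hint
    have hnn : 0 ≤ᵐ[gammaMeasure k A] f := hpos.mono fun x hx => hf0 x hx
    refine ⟨⟨hf.aestronglyMeasurable, ?_⟩, ?_⟩
    · rw [hasFiniteIntegral_iff_ofReal hnn, hint]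
      exact ENNReal.ofReal_lt_top
    · rw [integral_eq_lintegral_of_nonneg_ae hnn hf.aestronglyMeasurable, hint,
        ENNReal.toReal_ofReal hv]
  have hΓ2 : 0 < Real.Gamma (k - 2) := Real.Gamma_pos_of_pos (by linarith)
  have e1 : Real.Gamma (k - 1) = (k - 2) * Real.Gamma (k - 2) := by
    rw [← Real.Gamma_add_one (by linarith)]; congr 1; ring
  have e0 : Real.Gamma k = (k - 1) * Real.Gamma (k - 1) := by
    rw [← Real.Gamma_add_one (by linarith)]; congr 1; ring
  have hk1 : 0 < k - 1 := by linarith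
  have hk2 : 0 < k - 2 := by linarith
  have m1 := lintegral_rpow_mul_exp_gammaMeasure (k := k) (A := A) (r := -1) (u := 0)
    (by linarith) hA (by linarith) (by linarith)
  have m2 := lintegral_rpow_mul_exp_gammaMeasure (k := k) (A := A) (r := -2) (u := 0)
    (by linarith) hA (by linarith) (by linarith)
  constructor
  · refine aux (by fun_prop) (fun x hx => by positivity) (by positivity) ?_
    rw [← lintegral_congr_ae (hpos.mono fun x hx => ?_), m1]
    · congr 1
      rw [add_zero, ← sub_eq_add_neg, e0, e1, show -(k - 1) = 1 + -k by ring, Real.rpow_add hA,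
        Real.rpow_neg hA.le, Real.rpow_one]
      have : A ^ k ≠ 0 := by positivity
      field_simp
    · simp [Real.rpow_neg_one]
  · refine aux (by fun_prop) (fun x hx => by positivity) (by positivity) ?_
    rw [← lintegral_congr_ae (hpos.mono fun x hx => ?_), m2]
    · congr 1
      rw [add_zero, ← sub_eq_add_neg, e0, e1, show -(k - 2) = (2 : ℕ) + -k by push_cast; ring,
        Real.rpow_add hA, Real.rpow_neg hA.le, Real.rpow_natCast]
      have : A ^ k ≠ 0 := by positivity
      field_simp
    · simp [Real.rpow_neg hx.le]

/-- The `N_d` density with precision `2τ G`, as a function of the value `q` of the quadratic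
form of `G`, where `D = √(det G)`. -/
def precKernel (D : ℝ) (d : ℕ) (τ q : ℝ) : ℝ :=
  (τ / π) ^ ((d : ℝ) / 2) * D * Real.exp (-(τ * q))

/-- The multivariate `t` density obtained from `precKernel` by mixing its precision over
a Gamma distribution with shape `k` and rate `A`. -/
def tKernel (D : ℝ) (d : ℕ) (k A B q : ℝ) : ℝ :=
  (B / π) ^ ((d : ℝ) / 2) * D * (A ^ k / Real.Gamma k *
    (Real.Gamma (k + d / 2) * (A + B * q) ^ (-(k + d / 2))))

lemma precKernel_nonneg {D τ : ℝ} (hD : 0 ≤ D) (hτ : 0 ≤ τ) (d : ℕ) (q : ℝ) :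
    0 ≤ precKernel D d τ q := by
  unfold precKernel; positivity

lemma tKernel_nonneg {D k A B q : ℝ} (hD : 0 ≤ D) (hk : 0 < k) (hA : 0 < A) (hB : 0 < B)
    (hq : 0 ≤ q) (d : ℕ) : 0 ≤ tKernel D d k A B q := by
  have := Real.Gamma_pos_of_pos hk
  have : 0 < Real.Gamma (k + d / 2) := Real.Gamma_pos_of_pos (by positivity)
  unfold tKernel; positivity

lemma lintegral_precKernel_gammaMeasure {D k A B q : ℝ} (hD : 0 ≤ D) (hk : 0 < k) (hA : 0 < A)
    (hB : 0 < B) (hq : 0 ≤ q) (d : ℕ) :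
    ∫⁻ x, ENNReal.ofReal (precKernel D d (B * x) q) ∂gammaMeasure k A =
      ENNReal.ofReal (tKernel D d k A B q) := by
  have h : ∀ x : ℝ, 0 < x → ENNReal.ofReal (precKernel D d (B * x) q) =
      ENNReal.ofReal ((B / π) ^ ((d : ℝ) / 2) * D) *
        ENNReal.ofReal (x ^ ((d : ℝ) / 2) * Real.exp (-(B * q * x))) := by
    intro x hx
    rw [← ENNReal.ofReal_mul (by positivity), precKernel, mul_div_right_comm,
      Real.mul_rpow (by positivity) hx.le]
    congr 1
    ring_nf
  rw [lintegral_congr_ae ((gammaMeasure_ae_pos k A).mono h), lintegral_const_mul _ (by fun_prop),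
    lintegral_rpow_mul_exp_gammaMeasure hk hA (by positivity) (by positivity),
    ← ENNReal.ofReal_mul (by positivity), tKernel]

lemma sqrt_precKernel_mul {D τ₁ τ₂ : ℝ} (hD : 0 ≤ D) (h₁ : 0 < τ₁) (h₂ : 0 < τ₂) (d : ℕ) (q : ℝ) :
    √(precKernel D d τ₁ q * precKernel D d τ₂ q) =
      (τ₁ * τ₂ / ((τ₁ + τ₂) / 2) ^ 2) ^ ((d : ℝ) / 4) * precKernel D d ((τ₁ + τ₂) / 2) q := by
  have hs : 0 < (τ₁ + τ₂) / 2 := by positivity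
  refine (Real.sqrt_eq_iff_mul_self_eq (by unfold precKernel; positivity)
    (by unfold precKernel; positivity)).2 ?_
  have e1 : Real.exp (-((τ₁ + τ₂) / 2 * q)) * Real.exp (-((τ₁ + τ₂) / 2 * q)) =
      Real.exp (-(τ₁ * q)) * Real.exp (-(τ₂ * q)) := by
    rw [← Real.exp_add, ← Real.exp_add]; ring_nf
  have e2 : (τ₁ * τ₂ / ((τ₁ + τ₂) / 2) ^ 2) ^ ((d : ℝ) / 4) *
      (τ₁ * τ₂ / ((τ₁ + τ₂) / 2) ^ 2) ^ ((d : ℝ) / 4) *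
      (((τ₁ + τ₂) / 2 / π) ^ ((d : ℝ) / 2) * ((τ₁ + τ₂) / 2 / π) ^ ((d : ℝ) / 2)) =
      (τ₁ / π) ^ ((d : ℝ) / 2) * (τ₂ / π) ^ ((d : ℝ) / 2) := by
    rw [← Real.rpow_add (by positivity), ← Real.mul_rpow (by positivity) (by positivity),
      show (d : ℝ) / 4 + d / 4 = d / 2 by ring, ← Real.mul_rpow (by positivity) (by positivity),
      ← Real.mul_rpow (by positivity) (by positivity)]
    congr 1
    field_simp
  unfold precKernel
  linear_combination -D ^ 2 * ((τ₁ * τ₂ / ((τ₁ + τ₂) / 2) ^ 2) ^ ((d : ℝ) / 4) *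
      (τ₁ * τ₂ / ((τ₁ + τ₂) / 2) ^ 2) ^ ((d : ℝ) / 4) *
      (((τ₁ + τ₂) / 2 / π) ^ ((d : ℝ) / 2) * ((τ₁ + τ₂) / 2 / π) ^ ((d : ℝ) / 2))) * e1 -
      D ^ 2 * (Real.exp (-(τ₁ * q)) * Real.exp (-(τ₂ * q))) * e2

lemma one_sub_le_precision_affinity {τ₁ τ₂ : ℝ} (h₁ : 0 < τ₁) (h₂ : 0 < τ₂) (d : ℕ) :
    1 - d * (1 - τ₂ / τ₁) ^ 2 ≤ (τ₁ * τ₂ / ((τ₁ + τ₂) / 2) ^ 2) ^ ((d : ℝ) / 4) := by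
  have hr : τ₁ * τ₂ / ((τ₁ + τ₂) / 2) ^ 2 = 1 + -((τ₁ - τ₂) / (τ₁ + τ₂)) ^ 2 := by
    field_simp; ring
  have hle : ((τ₁ - τ₂) / (τ₁ + τ₂)) ^ 2 ≤ (1 - τ₂ / τ₁) ^ 2 := by
    rw [show 1 - τ₂ / τ₁ = (τ₁ - τ₂) / τ₁ by field_simp, div_pow, div_pow]
    gcongr
    linarith
  have hpos : 0 < τ₁ * τ₂ / ((τ₁ + τ₂) / 2) ^ 2 := by positivity
  have hle1 : τ₁ * τ₂ / ((τ₁ + τ₂) / 2) ^ 2 ≤ 1 := by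
    rw [hr]; linarith [sq_nonneg ((τ₁ - τ₂) / (τ₁ + τ₂))]
  calc 1 - d * (1 - τ₂ / τ₁) ^ 2 ≤ 1 + d * -((τ₁ - τ₂) / (τ₁ + τ₂)) ^ 2 := by
        nlinarith [Nat.cast_nonneg (α := ℝ) d]
    _ ≤ (1 + -((τ₁ - τ₂) / (τ₁ + τ₂)) ^ 2) ^ d :=
        one_add_mul_le_pow (by rw [hr] at hpos; linarith) d
    _ = (τ₁ * τ₂ / ((τ₁ + τ₂) / 2) ^ 2) ^ (d : ℝ) := by rw [hr, Real.rpow_natCast]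
    _ ≤ _ := Real.rpow_le_rpow_of_exponent_ge hpos hle1 (by
        linarith [Nat.cast_nonneg (α := ℝ) d])

lemma ofReal_integral_le_lintegral {Ω : Type*} [MeasurableSpace Ω] {μ : Measure Ω} {h : Ω → ℝ}
    (hh : Integrable h μ) : ENNReal.ofReal (∫ x, h x ∂μ) ≤ ∫⁻ x, ENNReal.ofReal (h x) ∂μ := by
  calc ENNReal.ofReal (∫ x, h x ∂μ) ≤ ENNReal.ofReal (∫ x, max (h x) 0 ∂μ) :=
        ENNReal.ofReal_le_ofReal
          (integral_mono hh hh.pos_part fun x => le_max_left _ _)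
    _ = ∫⁻ x, ENNReal.ofReal (max (h x) 0) ∂μ :=
        ofReal_integral_eq_lintegral_ofReal hh.pos_part (ae_of_all _ fun x => le_max_right _ _)
    _ = ∫⁻ x, ENNReal.ofReal (h x) ∂μ := by simp [ENNReal.ofReal_max]

lemma lintegral_ofReal_sqrt_le {Ω : Type*} [MeasurableSpace Ω] {μ : Measure Ω}
    [IsProbabilityMeasure μ] {h : Ω → ℝ} (hm : Measurable h) {v : ℝ}
    (hv : ∫⁻ x, ENNReal.ofReal (h x) ∂μ = ENNReal.ofReal v) :
    ∫⁻ x, ENNReal.ofReal (√(h x)) ∂μ ≤ ENNReal.ofReal (√v) := by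
  have key := ENNReal.lintegral_mul_le_Lp_mul_Lq μ Real.HolderConjugate.two_two
    (f := fun x => ENNReal.ofReal (√(h x))) (g := fun _ => 1) (by fun_prop) (by fun_prop)
  have hsq : ∀ t : ℝ, ENNReal.ofReal (√t) ^ (2 : ℝ) = ENNReal.ofReal t := by
    intro t
    rcases le_total 0 t with ht | ht
    · rw [ENNReal.ofReal_rpow_of_nonneg (Real.sqrt_nonneg _) (by norm_num), Real.rpow_two,
        Real.sq_sqrt ht]
    · simp [Real.sqrt_eq_zero_of_nonpos ht, ENNReal.ofReal_of_nonpos ht]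
  simp only [hsq, hv, Pi.mul_apply, mul_one, ENNReal.one_rpow, lintegral_one, measure_univ] at key
  refine key.trans (le_of_eq ?_)
  rw [← hsq v, ← ENNReal.rpow_mul]
  norm_num

section Affinity

variable {Ω : Type*} [MeasurableSpace Ω] {ν : Measure Ω} [SFinite ν] {q : Ω → ℝ}
  {D k A B τ₀ : ℝ} {d : ℕ}

lemma measurable_tKernel (hq : Measurable q) : Measurable fun b => tKernel D d k A B (q b) := by
  unfold tKernel; fun_prop

lemma measurable_precKernel (hq : Measurable q) (τ : ℝ) :
    Measurable fun b => precKernel D d τ (q b) := by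
  unfold precKernel; fun_prop

lemma measurable_uncurry_precKernel (hq : Measurable q) :
    Measurable fun z : Ω × ℝ => precKernel D d (B * z.2) (q z.1) := by
  unfold precKernel; fun_prop

lemma lintegral_tKernel (hqm : Measurable q) (hq : ∀ b, 0 ≤ q b) (hD : 0 ≤ D) (hk : 0 < k)
    (hA : 0 < A) (hB : 0 < B)
    (hnorm : ∀ τ, 0 < τ → ∫⁻ b, ENNReal.ofReal (precKernel D d τ (q b)) ∂ν = 1) :
    ∫⁻ b, ENNReal.ofReal (tKernel D d k A B (q b)) ∂ν = 1 := by
  have := isProbabilityMeasure_gammaMeasure hk hA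
  simp_rw [← fun b => lintegral_precKernel_gammaMeasure hD hk hA hB (hq b) d]
  rw [lintegral_lintegral_swap (measurable_uncurry_precKernel hqm).ennreal_ofReal.aemeasurable,
    lintegral_congr_ae ((gammaMeasure_ae_pos k A).mono fun x hx => hnorm (B * x) (by positivity))]
  simp

lemma lintegral_affinity_le_one (hqm : Measurable q) (hq : ∀ b, 0 ≤ q b) (hD : 0 ≤ D)
    (hk : 0 < k) (hA : 0 < A) (hB : 0 < B) (hτ₀ : 0 < τ₀)
    (hnorm : ∀ τ, 0 < τ → ∫⁻ b, ENNReal.ofReal (precKernel D d τ (q b)) ∂ν = 1) :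
    ∫⁻ b, ENNReal.ofReal (√(tKernel D d k A B (q b) * precKernel D d τ₀ (q b))) ∂ν ≤ 1 := by
  have hle : ∀ b, ENNReal.ofReal (√(tKernel D d k A B (q b) * precKernel D d τ₀ (q b))) ≤
      2⁻¹ * (ENNReal.ofReal (tKernel D d k A B (q b)) +
        ENNReal.ofReal (precKernel D d τ₀ (q b))) := by
    intro b
    have h1 := tKernel_nonneg hD hk hA hB (hq b) d
    have h2 := precKernel_nonneg hD hτ₀.le d (q b)
    rw [← ENNReal.ofReal_add h1 h2, ← ENNReal.ofReal_ofNat, ← ENNReal.ofReal_inv_of_pos two_pos,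
      ← ENNReal.ofReal_mul (by norm_num)]
    refine ENNReal.ofReal_le_ofReal (Real.sqrt_le_iff.2 ⟨by positivity, ?_⟩)
    nlinarith [sq_nonneg (tKernel D d k A B (q b) - precKernel D d τ₀ (q b))]
  refine (lintegral_mono hle).trans (le_of_eq ?_)
  have hmt : Measurable fun b => tKernel D d k A B (q b) := measurable_tKernel hqm
  have hmp : Measurable fun b => precKernel D d τ₀ (q b) := measurable_precKernel hqm τ₀
  rw [lintegral_const_mul _ (by fun_prop),
    lintegral_add_left (measurable_tKernel hqm).ennreal_ofReal,
    lintegral_tKernel hqm hq hD hk hA hB hnorm, hnorm τ₀ hτ₀, one_add_one_eq_two]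
  exact ENNReal.inv_mul_cancel two_ne_zero ENNReal.ofNat_ne_top

lemma le_lintegral_affinity (hqm : Measurable q) (hq : ∀ b, 0 ≤ q b) (hD : 0 ≤ D)
    (hk : 2 < k) (hA : 0 < A) (hB : 0 < B) (hτ₀ : 0 < τ₀)
    (hnorm : ∀ τ, 0 < τ → ∫⁻ b, ENNReal.ofReal (precKernel D d τ (q b)) ∂ν = 1) :
    ENNReal.ofReal (1 - d * (1 - 2 * (τ₀ / B) * (A / (k - 1)) +
        (τ₀ / B) ^ 2 * (A ^ 2 / ((k - 1) * (k - 2))))) ≤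
      ∫⁻ b, ENNReal.ofReal (√(tKernel D d k A B (q b) * precKernel D d τ₀ (q b))) ∂ν := by
  have hk0 : 0 < k := by linarith
  have := isProbabilityMeasure_gammaMeasure hk0 hA
  obtain ⟨⟨i1, m1⟩, ⟨i2, m2⟩⟩ := hasInvMoments_gammaMeasure hk hA
  have hexp : ∀ x : ℝ, 1 - d * (1 - τ₀ / (B * x)) ^ 2 =
      1 - d * (1 - 2 * (τ₀ / B) * x⁻¹ + (τ₀ / B) ^ 2 * (x ^ 2)⁻¹) := by
    intro x
    rw [div_mul_eq_div_div, div_eq_mul_inv (τ₀ / B) x]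
    ring
  have hint : Integrable (fun x : ℝ => 1 - d * (1 - τ₀ / (B * x)) ^ 2) (gammaMeasure k A) := by
    simp_rw [hexp]; fun_prop
  have hval : ∫ x, (1 - d * (1 - τ₀ / (B * x)) ^ 2) ∂gammaMeasure k A =
      1 - d * (1 - 2 * (τ₀ / B) * (A / (k - 1)) +
        (τ₀ / B) ^ 2 * (A ^ 2 / ((k - 1) * (k - 2)))) := by
    simp_rw [hexp]
    rw [integral_sub (by fun_prop) (by fun_prop), integral_const_mul,
      integral_add (by fun_prop) (by fun_prop), integral_sub (by fun_prop) (by fun_prop),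
      integral_const_mul, integral_const_mul, m1, m2]
    simp
  have hm : Measurable fun z : Ω × ℝ =>
      ENNReal.ofReal (√(precKernel D d (B * z.2) (q z.1) * precKernel D d τ₀ (q z.1))) := by
    have h1 := measurable_uncurry_precKernel (D := D) (d := d) (B := B) hqm
    have h2 := (measurable_precKernel (D := D) (d := d) hqm τ₀).comp
      (measurable_fst : Measurable (Prod.fst : Ω × ℝ → Ω))
    exact ((h1.mul h2).sqrt).ennreal_ofReal
  rw [← hval]
  calc ENNReal.ofReal (∫ x, (1 - d * (1 - τ₀ / (B * x)) ^ 2) ∂gammaMeasure k A)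
      ≤ ∫⁻ x, ENNReal.ofReal (1 - d * (1 - τ₀ / (B * x)) ^ 2) ∂gammaMeasure k A :=
        ofReal_integral_le_lintegral hint
    _ ≤ ∫⁻ x, ∫⁻ b, ENNReal.ofReal
          (√(precKernel D d (B * x) (q b) * precKernel D d τ₀ (q b))) ∂ν ∂gammaMeasure k A := by
        refine lintegral_mono_ae ((gammaMeasure_ae_pos k A).mono fun x hx => ?_)
        have hBx : 0 < B * x := by positivity
        simp_rw [sqrt_precKernel_mul hD hBx hτ₀]
        simp_rw [fun b => ENNReal.ofReal_mul (q := precKernel D d ((B * x + τ₀) / 2) (q b))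
          (show 0 ≤ (B * x * τ₀ / ((B * x + τ₀) / 2) ^ 2) ^ ((d : ℝ) / 4) by positivity)]
        rw [lintegral_const_mul _ (measurable_precKernel hqm _).ennreal_ofReal,
          hnorm _ (by positivity), mul_one]
        exact ENNReal.ofReal_le_ofReal (one_sub_le_precision_affinity hBx hτ₀ d)
    _ = ∫⁻ b, ∫⁻ x, ENNReal.ofReal
          (√(precKernel D d (B * x) (q b) * precKernel D d τ₀ (q b))) ∂gammaMeasure k A ∂ν :=
        (lintegral_lintegral_swap hm.aemeasurable).symm
    _ ≤ _ := by
        refine lintegral_mono fun b => ?_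
        have hp := precKernel_nonneg hD hτ₀.le d (q b)
        have ht := tKernel_nonneg hD hk0 hA hB (hq b) d
        rw [Real.sqrt_mul ht, ENNReal.ofReal_mul (Real.sqrt_nonneg _)]
        simp_rw [Real.sqrt_mul' _ hp, ENNReal.ofReal_mul (Real.sqrt_nonneg _)]
        have hmb : Measurable fun x => precKernel D d (B * x) (q b) := by
          unfold precKernel; fun_prop
        rw [lintegral_mul_const _ hmb.sqrt.ennreal_ofReal]
        gcongr
        exact lintegral_ofReal_sqrt_le hmb (lintegral_precKernel_gammaMeasure hD hk0 hA hB (hq b) d)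

/-- Two-sided bounds for the Hellinger affinity between a Gaussian and a multivariate `t`
density with common location and proportional scale matrices. -/
lemma integral_affinity_bounds (hqm : Measurable q) (hq : ∀ b, 0 ≤ q b) (hD : 0 ≤ D)
    (hk : 2 < k) (hA : 0 < A) (hB : 0 < B) (hτ₀ : 0 < τ₀)
    (hnorm : ∀ τ, 0 < τ → ∫⁻ b, ENNReal.ofReal (precKernel D d τ (q b)) ∂ν = 1) :
    1 - d * (1 - 2 * (τ₀ / B) * (A / (k - 1)) +
        (τ₀ / B) ^ 2 * (A ^ 2 / ((k - 1) * (k - 2)))) ≤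
      ∫ b, √(tKernel D d k A B (q b) * precKernel D d τ₀ (q b)) ∂ν ∧
    ∫ b, √(tKernel D d k A B (q b) * precKernel D d τ₀ (q b)) ∂ν ≤ 1 := by
  have hle := lintegral_affinity_le_one hqm hq hD (by linarith) hA hB hτ₀ hnorm (k := k)
  have hm : Measurable fun b => √(tKernel D d k A B (q b) * precKernel D d τ₀ (q b)) :=
    ((measurable_tKernel hqm).mul (measurable_precKernel hqm τ₀)).sqrt
  rw [integral_eq_lintegral_of_nonneg_ae (ae_of_all _ fun b => Real.sqrt_nonneg _)
    hm.aestronglyMeasurable]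
  constructor
  · have hge := le_lintegral_affinity hqm hq hD hk hA hB hτ₀ hnorm
    rw [ENNReal.ofReal_le_iff_le_toReal (ne_top_of_le_ne_top ENNReal.one_ne_top hle)] at hge
    exact hge
  · exact ENNReal.toReal_le_of_le_ofReal zero_le_one (by simpa using hle)

end Affinity

section QuadraticForm

variable {ι : Type*} [Fintype ι]

open scoped MatrixOrder in
lemma exists_eq_transpose_mul_self {G : Matrix ι ι ℝ} (hG : G.PosSemidef) :
    ∃ M : Matrix ι ι ℝ, G = Mᵀ * M := by
  obtain ⟨M, hM⟩ := CStarAlgebra.nonneg_iff_eq_star_mul_self.mp hG.nonneg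
  exact ⟨M, by rw [hM, Matrix.star_eq_conjTranspose, Matrix.conjTranspose_eq_transpose_of_trivial]⟩

lemma lintegral_exp_neg_mul_dotProduct_self {τ : ℝ} (hτ : 0 < τ) :
    ∫⁻ x : ι → ℝ, ENNReal.ofReal (Real.exp (-(τ * (x ⬝ᵥ x)))) =
      ENNReal.ofReal ((π / τ) ^ ((Fintype.card ι : ℝ) / 2)) := by
  have hprod : ∀ x : ι → ℝ, Real.exp (-(τ * (x ⬝ᵥ x))) = ∏ i, Real.exp (-τ * x i ^ 2) := by
    intro x
    rw [← Real.exp_sum, dotProduct, Finset.mul_sum, ← Finset.sum_neg_distrib]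
    congr 1
    exact Finset.sum_congr rfl fun i _ => by ring
  have hint : Integrable (fun x : ι → ℝ => ∏ i, Real.exp (-τ * x i ^ 2)) :=
    Integrable.fintype_prod fun i => integrable_exp_neg_mul_sq hτ
  simp_rw [hprod]
  rw [← ofReal_integral_eq_lintegral_ofReal hint
    (ae_of_all _ fun x => Finset.prod_nonneg fun i _ => (Real.exp_pos _).le),
    integral_fintype_prod_volume_eq_pow (fun x : ℝ => Real.exp (-τ * x ^ 2)), integral_gaussian,
    Real.sqrt_eq_rpow, ← Real.rpow_natCast, ← Real.rpow_mul (by positivity)]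
  ring_nf

lemma lintegral_precKernel_quadForm [DecidableEq ι] {M : Matrix ι ι ℝ} (hM : M.det ≠ 0) (m : ι → ℝ) {τ : ℝ}
    (hτ : 0 < τ) :
    ∫⁻ b : ι → ℝ, ENNReal.ofReal (precKernel |M.det| (Fintype.card ι) τ
      ((M *ᵥ (b - m)) ⬝ᵥ (M *ᵥ (b - m)))) = 1 := by
  have hmeas : Measurable fun x : ι → ℝ =>
      ENNReal.ofReal (precKernel |M.det| (Fintype.card ι) τ (x ⬝ᵥ x)) := by
    unfold precKernel dotProduct; fun_prop
  have hlin : Measurable (Matrix.toLin' M) := (LinearMap.continuous_on_pi _).measurable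
  rw [lintegral_sub_right_eq_self (fun b : ι → ℝ => ENNReal.ofReal
    (precKernel |M.det| (Fintype.card ι) τ ((M *ᵥ b) ⬝ᵥ (M *ᵥ b)))) m]
  have h := lintegral_map (μ := volume) hmeas hlin
  simp only [Matrix.toLin'_apply] at h
  rw [← h, Real.map_matrix_volume_pi_eq_smul_volume_pi hM, lintegral_smul_measure]
  have hdet : 0 < |M.det| := abs_pos.2 hM
  unfold precKernel
  simp_rw [fun x : ι → ℝ => ENNReal.ofReal_mul (q := Real.exp (-(τ * (x ⬝ᵥ x))))
    (show 0 ≤ (τ / π) ^ ((Fintype.card ι : ℝ) / 2) * |M.det| by positivity)]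
  rw [lintegral_const_mul _ (by unfold dotProduct; fun_prop),
    lintegral_exp_neg_mul_dotProduct_self hτ,
    smul_eq_mul, ← ENNReal.ofReal_mul (by positivity), ← ENNReal.ofReal_mul (by positivity),
    ← ENNReal.ofReal_one, abs_inv]
  congr 1
  have hone : (τ / π) ^ ((Fintype.card ι : ℝ) / 2) * (π / τ) ^ ((Fintype.card ι : ℝ) / 2) = 1 := by
    rw [← Real.mul_rpow (by positivity) (by positivity), div_mul_div_cancel₀ Real.pi_ne_zero,
      div_self hτ.ne', Real.one_rpow]
  field_simp
  rw [← hone]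

end QuadraticForm

section LinearModel

variable {n p : ℕ} {X : Matrix (Fin n) (Fin p) ℝ} {S : Finset (Fin p)}

lemma posSemidef_gram : (gram X S).PosSemidef := by
  rw [gram, ← Matrix.conjTranspose_eq_transpose_of_trivial]
  exact Matrix.posSemidef_conjTranspose_mul_self _

lemma rss_nonneg (y : Fin n → ℝ) : 0 ≤ rss X S y :=
  Finset.sum_nonneg fun _ _ => sq_nonneg _

lemma tCondDensity_eq_tKernel {a₀ b₀ γ α : ℝ} (hαγ : 0 < α + γ) (y : Fin n → ℝ)
    (b : {j // j ∈ S} → ℝ) :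
    tCondDensity X a₀ b₀ γ α y S b =
      tKernel (√(gram X S).det) S.card (n * α / 2 + a₀) (b₀ + α / 2 * rss X S y) ((α + γ) / 2)
        (quadForm X S y b) := by
  have hπ := Real.pi_pos
  have hc : (2 * π) ^ (-(S.card : ℝ) / 2) * √((α + γ) ^ S.card) =
      ((α + γ) / 2 / π) ^ ((S.card : ℝ) / 2) := by
    rw [Real.sqrt_eq_rpow, ← Real.rpow_natCast, ← Real.rpow_mul hαγ.le, neg_div,
      Real.rpow_neg (by positivity), div_div, Real.div_rpow hαγ.le (by positivity)]
    ring_nf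
  rw [tCondDensity, tKernel, Matrix.det_smul, Fintype.card_coe, Real.sqrt_mul (by positivity),
    ← hc, show (n : ℝ) * α / 2 + S.card / 2 + a₀ = n * α / 2 + a₀ + S.card / 2 by ring,
    show b₀ + (α + γ) / 2 * quadForm X S y b + α / 2 * rss X S y =
      b₀ + α / 2 * rss X S y + (α + γ) / 2 * quadForm X S y b by ring]
  ring

lemma gaussCondDensity_eq_precKernel {γ α v : ℝ} (hαγ : 0 < α + γ) (hv : 0 < v) (y : Fin n → ℝ)
    (b : {j // j ∈ S} → ℝ) :
    gaussCondDensity X γ α v y S b =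
      precKernel (√(gram X S).det) S.card ((α + γ) / (2 * v)) (quadForm X S y b) := by
  have hπ := Real.pi_pos
  rw [gaussCondDensity, precKernel, neg_div, Real.rpow_neg (by positivity),
    ← Real.inv_rpow (by positivity), neg_mul]
  congr 4
  field_simp

lemma measurable_betaHat : Measurable fun y : Fin n → ℝ => betaHat X S y := by
  unfold betaHat Matrix.mulVec dotProduct; fun_prop

lemma measurable_rss : Measurable fun y : Fin n → ℝ => rss X S y := by
  have := measurable_betaHat (X := X) (S := S)
  unfold rss yHat Matrix.mulVec dotProduct; fun_prop

lemma measurable_uncurry_quadForm :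
    Measurable fun z : (Fin n → ℝ) × ({j // j ∈ S} → ℝ) => quadForm X S z.1 z.2 := by
  have := measurable_betaHat (X := X) (S := S)
  unfold quadForm Matrix.mulVec dotProduct; simp only [Pi.sub_apply]; fun_prop

lemma measurable_affinity {a₀ b₀ γ α v : ℝ} :
    StronglyMeasurable fun y : Fin n → ℝ => ∫ b : {j // j ∈ S} → ℝ,
      √(tCondDensity X a₀ b₀ γ α y S b * gaussCondDensity X γ α v y S b) := by
  have h1 := measurable_uncurry_quadForm (X := X) (S := S)
  have h2 := measurable_rss (X := X) (S := S)
  refine StronglyMeasurable.integral_prod_right'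
    (f := fun z : (Fin n → ℝ) × ({j // j ∈ S} → ℝ) =>
      √(tCondDensity X a₀ b₀ γ α z.1 S z.2 * gaussCondDensity X γ α v z.1 S z.2))
    (Measurable.stronglyMeasurable ?_)
  unfold tCondDensity gaussCondDensity
  fun_prop

lemma affinity_bounds {a₀ b₀ γ α v : ℝ} (hdet : IsUnit (gram X S).det) (hb₀ : 0 < b₀)
    (hα : 0 < α) (hγ : 0 < γ) (hv : 0 < v) {k : ℝ} (hk : k = n * α / 2 + a₀) (hk2 : 2 < k)
    (y : Fin n → ℝ) :
    1 - S.card * (1 - 2 * v⁻¹ * ((b₀ + α / 2 * rss X S y) / (k - 1)) +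
        v⁻¹ ^ 2 * ((b₀ + α / 2 * rss X S y) ^ 2 / ((k - 1) * (k - 2)))) ≤
      ∫ b : {j // j ∈ S} → ℝ,
        √(tCondDensity X a₀ b₀ γ α y S b * gaussCondDensity X γ α v y S b) ∧
    ∫ b : {j // j ∈ S} → ℝ,
        √(tCondDensity X a₀ b₀ γ α y S b * gaussCondDensity X γ α v y S b) ≤ 1 := by
  obtain ⟨M, hM⟩ := exists_eq_transpose_mul_self (posSemidef_gram (X := X) (S := S))
  have hdetM : (gram X S).det = M.det * M.det := by rw [hM, Matrix.det_mul, Matrix.det_transpose]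
  have hM0 : M.det ≠ 0 := by
    intro h; rw [hdetM, h, mul_zero] at hdet; exact not_isUnit_zero hdet
  have hq : ∀ b, quadForm X S y b =
      (M *ᵥ (b - betaHat X S y)) ⬝ᵥ (M *ᵥ (b - betaHat X S y)) := by
    intro b
    rw [quadForm, hM, ← Matrix.mulVec_mulVec, Matrix.dotProduct_mulVec, Matrix.vecMul_transpose]
  have hαγ : 0 < α + γ := by positivity
  have hA : 0 < b₀ + α / 2 * rss X S y := by
    have := rss_nonneg (X := X) (S := S) y
    positivity
  have hratio : (α + γ) / (2 * v) / ((α + γ) / 2) = v⁻¹ := by field_simp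
  have hqm : Measurable fun b => quadForm X S y b :=
    (measurable_uncurry_quadForm (X := X) (S := S)).comp (measurable_prodMk_left (x := y))
  simp_rw [tCondDensity_eq_tKernel hαγ, gaussCondDensity_eq_precKernel hαγ hv, ← hk, ← hratio]
  refine integral_affinity_bounds hqm
    (fun b => ?_) (Real.sqrt_nonneg _) hk2 hA (by positivity) (by positivity) fun τ hτ => ?_
  · rw [hq, dotProduct]
    exact Finset.sum_nonneg fun _ _ => mul_self_nonneg _
  · simp_rw [hq, hdetM, Real.sqrt_mul_self_eq_abs]
    simpa using lintegral_precKernel_quadForm hM0 (betaHat X S y) hτ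

end LinearModel

section GaussianMoments

lemma memLp_sub_gaussianReal (m : ℝ) (v : ℝ≥0) {r : ℝ≥0∞} (hr : r ≠ ∞) :
    MemLp (fun x => x - m) r (gaussianReal m v) :=
  (memLp_id_gaussianReal' r hr).sub (memLp_const m)

lemma integrable_sub_pow_gaussianReal (m : ℝ) (v : ℝ≥0) {r : ℕ} (hr : r ≠ 0) :
    Integrable (fun x => (x - m) ^ r) (gaussianReal m v) :=
  integrable_norm_iff (by fun_prop) |>.1
    (by simpa using (memLp_sub_gaussianReal m v (ENNReal.natCast_ne_top r)).integrable_norm_pow hr)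

lemma integral_sub_gaussianReal (m : ℝ) (v : ℝ≥0) : ∫ x, (x - m) ∂gaussianReal m v = 0 := by
  have h : Integrable (fun x : ℝ => x) (gaussianReal m v) :=
    (memLp_id_gaussianReal 1).integrable (by simp)
  rw [integral_sub h (integrable_const m)]
  simp [integral_id_gaussianReal]

lemma integral_sub_sq_gaussianReal (m : ℝ) (v : ℝ≥0) :
    ∫ x, (x - m) ^ 2 ∂gaussianReal m v = v := by
  rw [← variance_fun_id_gaussianReal (μ := m) (v := v), variance_eq_integral (by fun_prop),
    integral_id_gaussianReal]

lemma integral_sub_pow_four_gaussianReal (m : ℝ) (v : ℝ≥0) :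
    ∫ x, (x - m) ^ 4 ∂gaussianReal m v = v ^ 2 * ∫ x, x ^ 4 ∂gaussianReal 0 1 := by
  have hmap : gaussianReal m v = (gaussianReal 0 1).map (fun x => √v * x + m) := by
    have h := gaussianReal_map_const_mul (μ := 0) (v := 1) (√v)
    have h2 := gaussianReal_map_add_const (μ := 0) (v := v) m
    rw [show (fun x : ℝ => √v * x + m) = (· + m) ∘ (√v * ·) from rfl,
      ← Measure.map_map (by fun_prop) (by fun_prop), h]
    have hv : NNReal.mk (√(v : ℝ) ^ 2) (sq_nonneg _) * 1 = v := by
      ext; simp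
    rw [hv, mul_zero, h2, zero_add]
  rw [hmap, integral_map (by fun_prop) (by fun_prop), ← integral_const_mul]
  congr with x
  have : (√(v : ℝ)) ^ 4 = v ^ 2 := by
    rw [show 4 = 2 * 2 by norm_num, pow_mul, Real.sq_sqrt (NNReal.coe_nonneg v)]
  rw [add_sub_cancel_right, mul_pow, this]

variable {n : ℕ} (m : Fin n → ℝ) (v : ℝ)

instance isProbabilityMeasure_gaussVec : IsProbabilityMeasure (gaussVec n m v) := by
  unfold gaussVec; infer_instance

lemma memLp_eval_sub_gaussVec (i : Fin n) : MemLp (fun y => y i - m i) 2 (gaussVec n m v) :=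
  (memLp_sub_gaussianReal (m i) v.toNNReal (by simp)).comp_measurePreserving
    (measurePreserving_eval (fun i => gaussianReal (m i) v.toNNReal) i)

lemma integral_mul_eval_sub_gaussVec (hv : 0 ≤ v) (i j : Fin n) :
    ∫ y, (y i - m i) * (y j - m j) ∂gaussVec n m v = if i = j then v else 0 := by
  split_ifs with h
  · subst h
    simp_rw [← pow_two]
    rw [gaussVec, integral_comp_eval (μ := fun i => gaussianReal (m i) v.toNNReal)
      (f := fun x => (x - m i) ^ 2) (by fun_prop), integral_sub_sq_gaussianReal,
      Real.coe_toNNReal v hv]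
  · have hind := (iIndepFun_pi (μ := fun i => gaussianReal (m i) v.toNNReal)
      (X := fun i x => x - m i) (fun i => by fun_prop)).indepFun h
    rw [gaussVec, hind.integral_fun_mul_eq_mul_integral
      ((measurable_pi_apply i).sub_const _).aestronglyMeasurable
      ((measurable_pi_apply j).sub_const _).aestronglyMeasurable,
      integral_comp_eval (μ := fun i => gaussianReal (m i) v.toNNReal)
      (f := fun x => x - m i) (by fun_prop), integral_sub_gaussianReal, zero_mul]

lemma integrable_mul_eval_sub_gaussVec (i j : Fin n) :
    Integrable (fun y => (y i - m i) * (y j - m j)) (gaussVec n m v) :=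
  (memLp_eval_sub_gaussVec m v i).integrable_mul (memLp_eval_sub_gaussVec m v j)

lemma integrable_quadForm_gaussVec (H : Matrix (Fin n) (Fin n) ℝ) :
    Integrable (fun y => (y - m) ⬝ᵥ (H *ᵥ (y - m))) (gaussVec n m v) := by
  simp only [dotProduct, Matrix.mulVec, Finset.mul_sum, Pi.sub_apply]
  refine integrable_finsetSum _ fun i _ => integrable_finsetSum _ fun j _ => ?_
  simpa only [mul_left_comm] using (integrable_mul_eval_sub_gaussVec m v i j).const_mul (H i j)

lemma integral_quadForm_gaussVec (hv : 0 ≤ v) (H : Matrix (Fin n) (Fin n) ℝ) :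
    ∫ y, (y - m) ⬝ᵥ (H *ᵥ (y - m)) ∂gaussVec n m v = v * H.trace := by
  have hterm : ∀ i j (y : Fin n → ℝ), (y i - m i) * (H i j * (y j - m j)) =
      H i j * ((y i - m i) * (y j - m j)) := fun i j y => by ring
  have hint := fun i j => (integrable_mul_eval_sub_gaussVec m v i j).const_mul (H i j)
  simp only [dotProduct, Matrix.mulVec, Finset.mul_sum, Pi.sub_apply, hterm]
  rw [integral_finsetSum _ fun i _ => integrable_finsetSum _ fun j _ => hint i j]
  simp_rw [fun i => integral_finsetSum Finset.univ (fun j _ => hint i j), integral_const_mul,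
    integral_mul_eval_sub_gaussVec m v hv]
  simp [Matrix.trace, Finset.mul_sum, mul_comm]

lemma memLp_dotProduct_self_gaussVec :
    MemLp (fun y => (y - m) ⬝ᵥ (y - m)) 2 (gaussVec n m v) := by
  have h4 : ∀ i, MemLp (fun x => (x - m i) ^ 2) 2 (gaussianReal (m i) v.toNNReal) := fun i =>
    (memLp_two_iff_integrable_sq (by fun_prop)).2
      (by simpa only [← pow_mul] using integrable_sub_pow_gaussianReal _ _ (by norm_num))
  simp only [dotProduct, Pi.sub_apply, ← pow_two]
  exact memLp_finsetSum _ fun i _ => (h4 i).comp_measurePreserving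
    (measurePreserving_eval (fun i => gaussianReal (m i) v.toNNReal) i)

lemma integral_dotProduct_self_gaussVec (hv : 0 ≤ v) :
    ∫ y, (y - m) ⬝ᵥ (y - m) ∂gaussVec n m v = n * v := by
  simpa [mul_comm] using integral_quadForm_gaussVec m v hv 1

lemma integral_dotProduct_self_sq_gaussVec_le (hv : 0 ≤ v) :
    ∫ y, ((y - m) ⬝ᵥ (y - m)) ^ 2 ∂gaussVec n m v ≤
      v ^ 2 * (n ^ 2 + n * ∫ x, x ^ 4 ∂gaussianReal 0 1) := by
  have h4 : ∀ i, MemLp (fun x => (x - m i) ^ 2) 2 (gaussianReal (m i) v.toNNReal) := fun i =>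
    (memLp_two_iff_integrable_sq (by fun_prop)).2
      (by simpa only [← pow_mul] using integrable_sub_pow_gaussianReal _ _ (by norm_num))
  have hvar := variance_eq_sub (memLp_dotProduct_self_gaussVec m v)
  have hsum := variance_sum_pi (X := fun i x => (x - m i) ^ 2) h4
  have hN : (fun y : Fin n → ℝ => (y - m) ⬝ᵥ (y - m)) = ∑ i, fun y => (y i - m i) ^ 2 := by
    ext y; simp [dotProduct, pow_two]
  have hle : ∑ i, Var[fun x => (x - m i) ^ 2; gaussianReal (m i) v.toNNReal] ≤
      n * (v ^ 2 * ∫ x, x ^ 4 ∂gaussianReal 0 1) := by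
    calc _ ≤ ∑ i : Fin n, v ^ 2 * ∫ x, x ^ 4 ∂gaussianReal 0 1 := by
          refine Finset.sum_le_sum fun i _ => ?_
          refine (variance_le_expectation_sq (by fun_prop)).trans (le_of_eq ?_)
          simp only [Pi.pow_apply, ← pow_mul]
          rw [integral_sub_pow_four_gaussianReal, Real.coe_toNNReal v hv]
      _ = _ := by simp
  rw [integral_dotProduct_self_gaussVec m v hv] at hvar
  simp only [Pi.pow_apply] at hvar
  rw [← hsum, ← hN] at hle
  change Var[_; gaussVec n m v] ≤ _ at hle
  linarith [hvar, hle]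

end GaussianMoments

section ResidualSumOfSquares

variable {n p : ℕ} {X : Matrix (Fin n) (Fin p) ℝ} {S : Finset (Fin p)}

lemma XS_suppFinset_mulVec (β : Fin p → ℝ) :
    XS X (suppFinset β) *ᵥ (fun j => β j.1) = X *ᵥ β := by
  ext i
  simp only [Matrix.mulVec, dotProduct, XS, Matrix.of_apply]
  rw [Finset.sum_coe_sort (suppFinset β) (fun j => X i j * β j)]
  exact Finset.sum_subset (Finset.subset_univ _) fun j _ hj => by
    have : β j = 0 := by simpa [suppFinset] using hj
    simp [this]

lemma transpose_projMat : (projMat X S)ᵀ = projMat X S := by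
  have hG : (gram X S)ᵀ = gram X S := by simp [gram]
  rw [projMat, Matrix.transpose_mul, Matrix.transpose_mul, Matrix.transpose_transpose,
    Matrix.transpose_nonsing_inv, hG, Matrix.mul_assoc]

lemma projMat_mul_XS (h : IsUnit (gram X S).det) : projMat X S * XS X S = XS X S := by
  rw [projMat, Matrix.mul_assoc, ← gram, Matrix.mul_assoc, Matrix.nonsing_inv_mul _ h,
    Matrix.mul_one]

lemma projMat_mul_self (h : IsUnit (gram X S).det) : projMat X S * projMat X S = projMat X S := by
  conv_lhs => rw [projMat.eq_def X S, ← Matrix.mul_assoc, ← Matrix.mul_assoc, ← projMat.eq_def X S,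
    projMat_mul_XS h]
  rw [projMat]

lemma trace_projMat (h : IsUnit (gram X S).det) : (projMat X S).trace = S.card := by
  rw [projMat, Matrix.trace_mul_comm, ← Matrix.mul_assoc, ← gram, Matrix.mul_nonsing_inv _ h,
    Matrix.trace_one, Fintype.card_coe]

lemma rss_eq (h : IsUnit (gram X S).det) {m : Fin n → ℝ} {c : {j // j ∈ S} → ℝ}
    (hm : XS X S *ᵥ c = m) (y : Fin n → ℝ) :
    rss X S y = (y - m) ⬝ᵥ (y - m) - (y - m) ⬝ᵥ (projMat X S *ᵥ (y - m)) := by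
  have hres : y - yHat X S y = (y - m) - projMat X S *ᵥ (y - m) := by
    have hPm : projMat X S *ᵥ m = m := by rw [← hm, Matrix.mulVec_mulVec, projMat_mul_XS h]
    rw [Matrix.mulVec_sub, hPm, yHat, betaHat, Matrix.mulVec_mulVec, ← Matrix.mul_assoc, ← projMat]
    abel
  have hPP : (projMat X S *ᵥ (y - m)) ⬝ᵥ (projMat X S *ᵥ (y - m)) =
      (y - m) ⬝ᵥ (projMat X S *ᵥ (y - m)) := by
    rw [Matrix.dotProduct_mulVec, ← Matrix.mulVec_transpose, transpose_projMat,
      Matrix.mulVec_mulVec, projMat_mul_self h, dotProduct_comm]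
  have hsq : rss X S y = (y - yHat X S y) ⬝ᵥ (y - yHat X S y) := by
    simp [rss, dotProduct, pow_two]
  rw [hsq, hres]
  generalize y - m = e at hPP
  rw [sub_dotProduct, dotProduct_sub, dotProduct_sub, hPP, dotProduct_comm (projMat X S *ᵥ e) e]
  ring

lemma dotProduct_projMat_nonneg (h : IsUnit (gram X S).det) (x : Fin n → ℝ) :
    0 ≤ x ⬝ᵥ (projMat X S *ᵥ x) := by
  rw [← projMat_mul_self h, ← Matrix.mulVec_mulVec, Matrix.dotProduct_mulVec,
    ← Matrix.mulVec_transpose, transpose_projMat, dotProduct]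
  exact Finset.sum_nonneg fun _ _ => mul_self_nonneg _

end ResidualSumOfSquares

section ExpectedAffinity

variable {n p : ℕ} {X : Matrix (Fin n) (Fin p) ℝ} {β : Fin p → ℝ} {a₀ b₀ γ α v : ℝ}

lemma integrable_affinity (hdet : IsUnit (gram X (suppFinset β)).det) (hb₀ : 0 < b₀)
    (hα : 0 < α) (hγ : 0 < γ) (hv : 0 < v) (hk2 : 2 < n * α / 2 + a₀) :
    Integrable (fun y => ∫ b : {j // j ∈ suppFinset β} → ℝ,
      √(tCondDensity X a₀ b₀ γ α y (suppFinset β) b *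
        gaussCondDensity X γ α v y (suppFinset β) b)) (dataDist X β v) := by
  unfold dataDist
  refine Integrable.of_bound measurable_affinity.aestronglyMeasurable 1 (ae_of_all _ fun y => ?_)
  rw [Real.norm_of_nonneg (integral_nonneg fun _ => Real.sqrt_nonneg _)]
  exact (affinity_bounds hdet hb₀ hα hγ hv rfl hk2 y).2

lemma integral_affinity_le_one (hdet : IsUnit (gram X (suppFinset β)).det) (hb₀ : 0 < b₀)
    (hα : 0 < α) (hγ : 0 < γ) (hv : 0 < v) (hk2 : 2 < n * α / 2 + a₀) :
    ∫ y, (∫ b : {j // j ∈ suppFinset β} → ℝ,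
      √(tCondDensity X a₀ b₀ γ α y (suppFinset β) b *
        gaussCondDensity X γ α v y (suppFinset β) b)) ∂dataDist X β v ≤ 1 := by
  have : IsProbabilityMeasure (dataDist X β v) := isProbabilityMeasure_gaussVec _ _
  calc _ ≤ ∫ _, (1 : ℝ) ∂dataDist X β v :=
        integral_mono (integrable_affinity hdet hb₀ hα hγ hv hk2) (integrable_const _)
          fun y => (affinity_bounds hdet hb₀ hα hγ hv rfl hk2 y).2
    _ = 1 := by simp

lemma le_integral_affinity (hdet : IsUnit (gram X (suppFinset β)).det) (hb₀ : 0 < b₀)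
    (hα : 0 < α) (hγ : 0 < γ) (hv : 0 < v) {k s : ℝ} (hk : k = n * α / 2 + a₀) (hk2 : 2 < k)
    (hs : ((suppFinset β).card : ℝ) = s) :
    1 - s * (1 - 2 * (b₀ / v + α * n / 2 - α * s / 2) / (k - 1) +
        ((b₀ / v) ^ 2 + b₀ / v * (α * n) +
          α ^ 2 / 4 * (n ^ 2 + n * ∫ x, x ^ 4 ∂gaussianReal 0 1)) / ((k - 1) * (k - 2))) ≤
      ∫ y, (∫ b : {j // j ∈ suppFinset β} → ℝ,
        √(tCondDensity X a₀ b₀ γ α y (suppFinset β) b *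
          gaussCondDensity X γ α v y (suppFinset β) b)) ∂dataDist X β v := by
  set m := X *ᵥ β
  set H := projMat X (suppFinset β)
  set C := ∫ x, x ^ 4 ∂gaussianReal 0 1
  set N : (Fin n → ℝ) → ℝ := fun y => (y - m) ⬝ᵥ (y - m)
  set W : (Fin n → ℝ) → ℝ := fun y => (y - m) ⬝ᵥ (H *ᵥ (y - m))
  set D := (k - 1) * (k - 2)
  have hD : 0 < D := mul_pos (by linarith) (by linarith)
  have hk1 : 0 < k - 1 := by linarith
  have hs0 : 0 ≤ s := hs ▸ Nat.cast_nonneg _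
  have hNL : MemLp N 2 (gaussVec n m v) := memLp_dotProduct_self_gaussVec m v
  have hNi : Integrable N (gaussVec n m v) := hNL.integrable (by norm_num)
  have hN2i : Integrable (fun y => N y ^ 2) (gaussVec n m v) := hNL.integrable_sq
  have hWi : Integrable W (gaussVec n m v) := integrable_quadForm_gaussVec m v H
  have hN : ∫ y, N y ∂gaussVec n m v = n * v := integral_dotProduct_self_gaussVec m v hv.le
  have hN2 : ∫ y, N y ^ 2 ∂gaussVec n m v ≤ v ^ 2 * (n ^ 2 + n * C) :=
    integral_dotProduct_self_sq_gaussVec_le m v hv.le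
  have hW : ∫ y, W y ∂gaussVec n m v = v * s := by
    rw [integral_quadForm_gaussVec m v hv.le H, trace_projMat hdet, hs]
  set c₀ := 1 - s * (1 - 2 * v⁻¹ * (b₀ / (k - 1)) + v⁻¹ ^ 2 * (b₀ ^ 2 / D))
  set c₁ := s * (v⁻¹ * (α / (k - 1)) - v⁻¹ ^ 2 * (b₀ * α / D))
  set c₂ := s * (v⁻¹ * (α / (k - 1)))
  set c₃ := s * (v⁻¹ ^ 2 * (α ^ 2 / 4 / D))
  have hc₃ : 0 ≤ c₃ := by positivity
  have hpt : ∀ y, c₀ + c₁ * N y - c₂ * W y - c₃ * N y ^ 2 ≤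
      ∫ b : {j // j ∈ suppFinset β} → ℝ,
        √(tCondDensity X a₀ b₀ γ α y (suppFinset β) b *
          gaussCondDensity X γ α v y (suppFinset β) b) := by
    intro y
    refine le_trans ?_ (affinity_bounds hdet hb₀ hα hγ hv hk hk2 y).1
    have hrss : rss X (suppFinset β) y = N y - W y := rss_eq hdet (XS_suppFinset_mulVec β) y
    have hWnn : 0 ≤ W y := dotProduct_projMat_nonneg hdet _
    have hrn : 0 ≤ N y - W y := hrss ▸ rss_nonneg y
    have hsq : (b₀ + α / 2 * (N y - W y)) ^ 2 ≤ (b₀ + α / 2 * N y) ^ 2 := by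
      gcongr
      linarith
    have hmain : s * (v⁻¹ ^ 2 * ((b₀ + α / 2 * (N y - W y)) ^ 2 / D)) ≤
        s * (v⁻¹ ^ 2 * ((b₀ + α / 2 * N y) ^ 2 / D)) := by gcongr
    have hexp : c₀ + c₁ * N y - c₂ * W y - c₃ * N y ^ 2 =
        1 - s * (1 - 2 * v⁻¹ * ((b₀ + α / 2 * (N y - W y)) / (k - 1))) -
          s * (v⁻¹ ^ 2 * ((b₀ + α / 2 * N y) ^ 2 / D)) := by
      simp only [c₀, c₁, c₂, c₃]
      ring
    rw [hrss, hs, hexp]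
    linarith
  calc _ ≤ c₀ + c₁ * (n * v) - c₂ * (v * s) - c₃ * (v ^ 2 * (n ^ 2 + n * C)) := by
        refine le_of_eq ?_
        simp only [c₀, c₁, c₂, c₃]
        field_simp
        ring
    _ ≤ c₀ + c₁ * (n * v) - c₂ * (v * s) - c₃ * ∫ y, N y ^ 2 ∂gaussVec n m v := by gcongr
    _ = ∫ y, (c₀ + c₁ * N y - c₂ * W y - c₃ * N y ^ 2) ∂gaussVec n m v := by
        have h0 : Integrable (fun _ : Fin n → ℝ => c₀) (gaussVec n m v) := integrable_const _
        have h01 : Integrable (fun y => c₀ + c₁ * N y) (gaussVec n m v) :=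
          h0.add (hNi.const_mul c₁)
        have h012 : Integrable (fun y => c₀ + c₁ * N y - c₂ * W y) (gaussVec n m v) :=
          h01.sub (hWi.const_mul c₂)
        rw [integral_sub h012 (hN2i.const_mul c₃), integral_sub h01 (hWi.const_mul c₂),
          integral_add h0 (hNi.const_mul c₁)]
        simp [integral_const_mul, hN, hW]
    _ ≤ _ := by
        refine integral_mono ?_ (integrable_affinity hdet hb₀ hα hγ hv (hk ▸ hk2)) hpt
        exact (((integrable_const c₀).add (hNi.const_mul c₁)).sub (hWi.const_mul c₂)).sub
          (hN2i.const_mul c₃)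

lemma affinity_deficit_le {n s k e e₁ C : ℝ} (ha₀ : 0 < a₀) (hα : 0 < α) (he : 0 < e)
    (he₁ : e ≤ e₁) (hC : 0 ≤ C) (hs : 0 ≤ s) (hss : s ≤ s ^ 2) (hn : 8 ≤ α * n)
    (hk : k = n * α / 2 + a₀) :
    s * (1 - 2 * (e + α * n / 2 - α * s / 2) / (k - 1) +
        (e ^ 2 + e * (α * n) + α ^ 2 / 4 * (n ^ 2 + n * C)) / ((k - 1) * (k - 2))) ≤
      2 * (4 * (1 + α / 2 * C + (a₀ ^ 2 + 2 + e₁ ^ 2 + 4 * e₁)) + 2 * α) / α * (s ^ 2 / n) := by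
  obtain ⟨t, ht⟩ : ∃ t, t = α * n / 2 := ⟨_, rfl⟩
  have hn' : n = 2 * t / α := by rw [ht]; field_simp
  have ht4 : 4 ≤ t := by linarith
  have hkt : k = t + a₀ := by rw [hk, ht]; ring
  have hk1 : t / 2 ≤ k - 1 := by linarith
  have hk2 : t / 2 ≤ k - 2 := by linarith
  have ht0 : 0 < t := by linarith
  have hk1' : 0 < k - 1 := by linarith
  have hk2' : 0 < k - 2 := by linarith
  have he₁0 : 0 < e₁ := he.trans_le he₁
  set K := 1 + α / 2 * C + (a₀ ^ 2 + 2 + e₁ ^ 2 + 4 * e₁)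
  have hK : 0 ≤ K := by positivity
  have hnum : t * (1 + α / 2 * C) + (a₀ - 1) * (a₀ - 2) + e ^ 2 - 2 * e * (a₀ - 2) ≤ K * t := by
    have h1 : e ^ 2 ≤ e₁ ^ 2 := by gcongr
    have h2 : 0 ≤ e * a₀ := by positivity
    have h3 : a₀ ^ 2 + 2 + e₁ ^ 2 + 4 * e₁ ≤ (a₀ ^ 2 + 2 + e₁ ^ 2 + 4 * e₁) * t :=
      le_mul_of_one_le_right (by positivity) (by linarith)
    simp only [K]
    nlinarith
  have hfrac : (t * (1 + α / 2 * C) + (a₀ - 1) * (a₀ - 2) + e ^ 2 - 2 * e * (a₀ - 2)) /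
      ((k - 1) * (k - 2)) ≤ 4 * K / t := by
    calc _ ≤ K * t / (t / 2 * (t / 2)) := by gcongr
      _ = 4 * K / t := by field_simp; norm_num
  have hlin : α * s / (k - 1) ≤ 2 * α * s / t := by
    calc _ ≤ α * s / (t / 2) := by gcongr
      _ = _ := by field_simp
  calc _ = s * ((t * (1 + α / 2 * C) + (a₀ - 1) * (a₀ - 2) + e ^ 2 - 2 * e * (a₀ - 2)) /
        ((k - 1) * (k - 2)) + α * s / (k - 1)) := by
        rw [hn']
        field_simp
        rw [hkt]
        ring
    _ ≤ s * (4 * K / t + 2 * α * s / t) := by gcongr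
    _ = (4 * K * s + 2 * α * s ^ 2) / t := by ring
    _ ≤ (4 * K * s ^ 2 + 2 * α * s ^ 2) / t := by gcongr
    _ = _ := by rw [hn']; field_simp

lemma tendsto_sq_div_zero_of_isLittleO_sqrt_div_log {u : ℕ → ℝ}
    (h : u =o[atTop] fun n : ℕ => √n / Real.log n) :
    Tendsto (fun n : ℕ => u n ^ 2 / n) atTop (nhds 0) := by
  have hO : (fun n : ℕ => √(n : ℝ) / Real.log n) =O[atTop] fun n : ℕ => √(n : ℝ) := by
    refine Asymptotics.IsBigO.of_bound 1 ?_
    filter_upwards [(Real.tendsto_log_atTop.comp tendsto_natCast_atTop_atTop).eventually_ge_atTop 1]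
      with n hn
    simp only [Function.comp_apply] at hn
    rw [one_mul, norm_div, Real.norm_of_nonneg (by linarith : 0 ≤ Real.log n)]
    exact div_le_self (norm_nonneg _) hn
  have := (h.trans_isBigO hO).tendsto_div_nhds_zero.pow 2
  simpa [div_pow, Real.sq_sqrt] using this

lemma card_suppFinset {p : ℕ} (β : Fin p → ℝ) :
    (suppFinset β).card = (Function.support β).ncard := by
  rw [← Set.ncard_coe_finset]
  congr 1
  ext j
  simp [suppFinset]

end ExpectedAffinity

/-- Hellinger affinity between the conditional posterior at the true model and its
Gaussian limit (key step in the Bernstein–von Mises theorem): if `s* = o(√n/log n)`,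
then `E_{β*}[∫ √(π^n(β_{S*}|S*) φ(β_{S*}; β̂_{S*}, (σ₀²/(α+γ))(X_{S*}ᵀX_{S*})⁻¹)) dβ_{S*}]
→ 1`. -/
theorem hellinger_affinity_true_model
    (p R sstar : ℕ → ℕ) (X : ∀ n, Matrix (Fin n) (Fin (p n)) ℝ)
    (βstar : ∀ n, Fin (p n) → ℝ) (σ0sq : ℕ → ℝ) (a₀ b₀ a c γ α d₁ d₂ : ℝ)
    (ha₀ : 0 < a₀) (hb₀ : 0 < b₀) (ha : 0 < a) (hc : 0 < c) (hγ : 0 < γ)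
    (hα0 : 0 < α) (hα1 : α < 1)
    (hnp : ∀ n, n ≤ p n) (hptop : Tendsto (fun n => p n) atTop atTop)
    (hrank : ∀ n, (X n).rank = R n)
    (hinv : ∀ n (S : Finset (Fin (p n))), S.card ≤ R n → IsUnit (gram (X n) S).det)
    (hsstar : ∀ n, sstar n = (Function.support (βstar n)).ncard)
    (hsR : ∀ n, sstar n ≤ R n)
    (hd₁ : 0 < d₁) (hA1 : ∀ n, d₁ < σ0sq n ∧ σ0sq n < d₂)
    -- `s* = o(√n / log n)`
    (hsO : (fun n => (sstar n : ℝ)) =o[atTop] fun n => Real.sqrt n / Real.log n) :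
    Tendsto (fun n =>
      ∫ y, (∫ b : {j // j ∈ suppFinset (βstar n)} → ℝ,
          Real.sqrt (tCondDensity (X n) a₀ b₀ γ α y (suppFinset (βstar n)) b *
            gaussCondDensity (X n) γ α (σ0sq n) y (suppFinset (βstar n)) b))
        ∂(dataDist (X n) (βstar n) (σ0sq n))) atTop (nhds 1) := by
  have hcard : ∀ n, (suppFinset (βstar n)).card = sstar n := fun n =>
    (card_suppFinset _).trans (hsstar n).symm
  have hdet : ∀ n, IsUnit (gram (X n) (suppFinset (βstar n))).det := fun n =>
    hinv n _ ((hcard n).trans_le (hsR n))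
  have hv : ∀ n, 0 < σ0sq n := fun n => hd₁.trans (hA1 n).1
  have hn : ∀ᶠ n : ℕ in atTop, 8 ≤ α * n :=
    (tendsto_natCast_atTop_atTop.const_mul_atTop hα0).eventually_ge_atTop 8
  have hC : 0 ≤ ∫ x, x ^ 4 ∂gaussianReal 0 1 := integral_nonneg fun x => by positivity
  have hlim := (tendsto_sq_div_zero_of_isLittleO_sqrt_div_log hsO).const_mul
    (2 * (4 * (1 + α / 2 * (∫ x, x ^ 4 ∂gaussianReal 0 1) +
      (a₀ ^ 2 + 2 + (b₀ / d₁) ^ 2 + 4 * (b₀ / d₁))) + 2 * α) / α)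
  refine tendsto_of_tendsto_of_tendsto_of_le_of_le' (by simpa using hlim.const_sub 1)
    tendsto_const_nhds ?_ ?_
  · filter_upwards [hn] with n hn
    refine le_trans ?_ (le_integral_affinity (hdet n) hb₀ hα0 hγ (hv n) rfl (by linarith)
      (congrArg Nat.cast (hcard n)))
    refine sub_le_sub_left (affinity_deficit_le ha₀ hα0 (div_pos hb₀ (hv n)) ?_ hC
      (Nat.cast_nonneg _) ?_ hn rfl) 1
    · exact div_le_div_of_nonneg_left hb₀.le hd₁ (hA1 n).1.le
    · exact_mod_cast Nat.le_self_pow two_ne_zero _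
  · filter_upwards [hn] with n hn
    exact integral_affinity_le_one (hdet n) hb₀ hα0 hγ (hv n) (by linarith)

end EmpiricalBayes
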